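/- arXiv:1805.11854 — 11 statements merged into one kernel-verified Lean document; each statement's English description precedes it below -/
import Mathlib

section
/- Let α_max > 0, c > 0, and let α satisfy 0 < α ≤ α_max and 2δ^p ≤ c·α. If u ∈ D is a Tikhonov minimizer for parameter α, i.e. ‖F(u) − v^δ‖^p + α·R(u) ≤ ‖F(w) − v^δ‖^p + α·R(w) for all w ∈ D, then ‖F(u) − v‖^p + α_max·R(u) ≤ 2^{p−1}·α_max·(c + R(u†)); in other words, u belongs to the level set M(ρ₁) with ρ₁ = 2^{p−1}·α_max·(c + R(u†)). -/
/-- a Tikhonov minimizer belongs to the level set `M(ρ₁)`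
with `ρ₁ = 2^(p-1) · α_max · (c + R(u†))`. -/
theorem tikhonov_minimizer_mem_level_set
    {U V : Type*} [NormedAddCommGroup U] [NormedSpace ℝ U]
    [NormedAddCommGroup V] [NormedSpace ℝ V]
    (F : U → V) (D : Set U) (hD : D.Nonempty)
    (R : U → ℝ) (hR : ∀ u, 0 ≤ R u)
    (p : ℝ) (hp : 1 ≤ p)
    (v : V) (udag : U) (hudagD : udag ∈ D) (hFudag : F udag = v)
    (δ : ℝ) (hδ : 0 < δ) (vδ : V) (hvδ : ‖vδ - v‖ ≤ δ)
    (αmax : ℝ) (hαmax : 0 < αmax) (c : ℝ) (hc : 0 < c)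
    (α : ℝ) (hα : 0 < α) (hααmax : α ≤ αmax) (hδα : 2 * δ ^ p ≤ c * α)
    (u : U) (huD : u ∈ D)
    (hmin : ∀ w ∈ D, ‖F u - vδ‖ ^ p + α * R u ≤ ‖F w - vδ‖ ^ p + α * R w) :
    ‖F u - v‖ ^ p + αmax * R u ≤ 2 ^ (p - 1) * αmax * (c + R udag) := by
  have h0 := hmin udag hudagD
  rw [hFudag, norm_sub_rev v vδ] at h0
  have hp0 : 0 ≤ p := by linarith
  have hd : ‖vδ - v‖ ^ p ≤ δ ^ p := Real.rpow_le_rpow (norm_nonneg _) hvδ hp0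
  have htri : ‖F u - v‖ ≤ ‖F u - vδ‖ + ‖vδ - v‖ := norm_sub_le_norm_sub_add_norm_sub _ _ _
  have h1 : ‖F u - v‖ ^ p ≤ (‖F u - vδ‖ + ‖vδ - v‖) ^ p :=
    Real.rpow_le_rpow (norm_nonneg _) htri hp0
  have h2 : (‖F u - vδ‖ + ‖vδ - v‖) ^ p
      ≤ 2 ^ (p - 1) * (‖F u - vδ‖ ^ p + ‖vδ - v‖ ^ p) :=
    by exact_mod_cast NNReal.rpow_add_le_mul_rpow_add_rpow ‖F u - vδ‖₊ ‖vδ - v‖₊ hp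
  have hA : (1 : ℝ) ≤ 2 ^ (p - 1) := Real.one_le_rpow (by norm_num) (by linarith)
  have ha : 0 ≤ ‖F u - vδ‖ ^ p := Real.rpow_nonneg (norm_nonneg _) _
  generalize ‖F u - vδ‖ ^ p = a at *
  generalize ‖vδ - v‖ ^ p = e at *
  generalize (2 : ℝ) ^ (p - 1) = A at *
  have hRu : R u ≤ c / 2 + R udag := by
    have : α * R u ≤ α * (c / 2 + R udag) := by linarith
    exact le_of_mul_le_mul_left this hα
  have h3 : (αmax - α) * R u ≤ (αmax - α) * (c / 2 + R udag) :=
    mul_le_mul_of_nonneg_left hRu (by linarith)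
  have h4 : α * c ≤ αmax * c := mul_le_mul_of_nonneg_right hααmax hc.le
  have h5 : a + e + αmax * R u ≤ αmax * (c + R udag) := by linarith
  have h6 : A * (a + e + αmax * R u) ≤ A * (αmax * (c + R udag)) :=
    mul_le_mul_of_nonneg_left h5 (by linarith)
  have h7 : 1 * (αmax * R u) ≤ A * (αmax * R u) :=
    mul_le_mul_of_nonneg_right hA (mul_nonneg hαmax.le (hR u))
  linarith
end

section
/- (Theorem 3.1, explicit form) Let α_max > 0, c > 0, set ρ = α_max·(c + R(u†)) and ρ₁ = 2^{p−1}·ρ. Let ζ : U → ℝ be a continuous linear functional, C > 0 a constant and ð an index function such that the conditional stability estimate D_ζ(u, u†) ≤ C·ð(‖F(u) − F(u†)‖) holds for every u ∈ M(ρ₁). If 0 < α ≤ α_max, 2δ^p ≤ c·α, and u_α^δ ∈ D is a Tikhonov minimizer for parameter α, then D_ζ(u_α^δ, u†) ≤ C·ð(α^{1/p}·(c/2 + ρ/α_max)^{1/p} + δ). -/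
/-- Theorem 3.1, explicit form: convergence estimate in Bregman
distance from a conditional stability estimate on the level set `M(ρ₁)`. -/
theorem bregman_estimate_of_conditional_stability
    {U V : Type*} [NormedAddCommGroup U] [NormedSpace ℝ U]
    [NormedAddCommGroup V] [NormedSpace ℝ V]
    (F : U → V) (D : Set U) (hD : D.Nonempty)
    (R : U → ℝ) (hR : ∀ u, 0 ≤ R u)
    (p : ℝ) (hp : 1 ≤ p)
    (v : V) (udag : U) (hudagD : udag ∈ D) (hFudag : F udag = v)
    (δ : ℝ) (hδ : 0 < δ) (vδ : V) (hvδ : ‖vδ - v‖ ≤ δ)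
    (αmax : ℝ) (hαmax : 0 < αmax) (c : ℝ) (hc : 0 < c)
    (ρ ρ₁ : ℝ) (hρ : ρ = αmax * (c + R udag)) (hρ₁ : ρ₁ = 2 ^ (p - 1) * ρ)
    (ζ : U →L[ℝ] ℝ) (C : ℝ) (hC : 0 < C)
    (idx : ℝ → ℝ) (hidx_cont : ContinuousOn idx (Set.Ici 0))
    (hidx_mono : StrictMonoOn idx (Set.Ici 0)) (hidx_zero : idx 0 = 0)
    (hidx_nonneg : ∀ t, 0 ≤ t → 0 ≤ idx t)
    (hstab : ∀ u ∈ D, ‖F u - v‖ ^ p + αmax * R u ≤ ρ₁ →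
      R u - R udag - ζ (u - udag) ≤ C * idx ‖F u - F udag‖)
    (α : ℝ) (hα : 0 < α) (hααmax : α ≤ αmax) (hδα : 2 * δ ^ p ≤ c * α)
    (uαδ : U) (huD : uαδ ∈ D)
    (hmin : ∀ w ∈ D, ‖F uαδ - vδ‖ ^ p + α * R uαδ ≤ ‖F w - vδ‖ ^ p + α * R w) :
    R uαδ - R udag - ζ (uαδ - udag) ≤
      C * idx (α ^ (1 / p) * (c / 2 + ρ / αmax) ^ (1 / p) + δ) := by
  have hp0 : 0 < p := by linarith
  have hRd := hR udag
  have hRu := hR uαδ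
  have hm := hmin udag hudagD
  rw [hFudag, norm_sub_rev v vδ] at hm
  have hδp : ‖vδ - v‖ ^ p ≤ δ ^ p := Real.rpow_le_rpow (norm_nonneg _) hvδ hp0.le
  have ha0 : 0 ≤ ‖F uαδ - vδ‖ := norm_nonneg _
  have htri : ‖F uαδ - v‖ ≤ ‖F uαδ - vδ‖ + δ := by
    have h := norm_sub_le_norm_sub_add_norm_sub (F uαδ) vδ v
    linarith
  generalize ‖F uαδ - vδ‖ = a at *
  have hap0 : 0 ≤ a ^ p := Real.rpow_nonneg ha0 p
  have hconv : (a + δ) ^ p ≤ 2 ^ (p - 1) * (a ^ p + δ ^ p) := by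
    have h := NNReal.rpow_add_le_mul_rpow_add_rpow ⟨a, ha0⟩ ⟨δ, hδ.le⟩ hp
    exact_mod_cast h
  have hpow : ‖F uαδ - v‖ ^ p ≤ (a + δ) ^ p :=
    Real.rpow_le_rpow (norm_nonneg _) htri hp0.le
  have h2 : (1 : ℝ) ≤ 2 ^ (p - 1) := Real.one_le_rpow (by norm_num) (by linarith)
  have hlev : ‖F uαδ - v‖ ^ p + αmax * R uαδ ≤ ρ₁ := by
    have h1 : a ^ p + α * R uαδ ≤ α * (c / 2 + R udag) := by linarith
    have h3 : a ^ p + αmax * R uαδ ≤ αmax * (c / 2 + R udag) := by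
      have h4 : R uαδ - (c / 2 + R udag) ≤ 0 := by
        by_contra hcon
        push Not at hcon
        nlinarith
      nlinarith
    have h5 : a ^ p + δ ^ p + αmax * R uαδ ≤ ρ := by
      rw [hρ]; nlinarith
    have h6 : αmax * R uαδ ≤ 2 ^ (p - 1) * (αmax * R uαδ) :=
      le_mul_of_one_le_left (by positivity) h2
    have h7 := mul_le_mul_of_nonneg_left h5 (zero_le_one.trans h2)
    rw [hρ₁]
    linarith
  have hs := hstab uαδ huD hlev
  refine hs.trans (mul_le_mul_of_nonneg_left ?_ hC.le)
  have hq : ρ / αmax = c + R udag := by rw [hρ]; field_simp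
  rw [hq, hFudag]
  have hX : 0 ≤ c / 2 + (c + R udag) := by positivity
  have hale : a ≤ α ^ (1 / p) * (c / 2 + (c + R udag)) ^ (1 / p) := by
    rw [← Real.mul_rpow hα.le hX, one_div, Real.le_rpow_inv_iff_of_pos ha0 (by positivity) hp0]
    nlinarith [mul_nonneg hα.le hRu]
  have hle : ‖F uαδ - v‖ ≤ α ^ (1 / p) * (c / 2 + (c + R udag)) ^ (1 / p) + δ := by linarith
  exact hidx_mono.monotoneOn (norm_nonneg _) ((norm_nonneg _).trans hle) hle
end

section
/- (Theorem 3.1, rate form) Let α_max > 0, c > 0, ρ = α_max·(c + R(u†)), ρ₁ = 2^{p−1}·ρ, and let ζ : U → ℝ be a continuous linear functional, C > 0 and ð an index function with D_ζ(u, u†) ≤ C·ð(‖F(u) − F(u†)‖) for every u ∈ M(ρ₁). Fix 0 < ε < p and suppose δ ≤ 1, α = δ^{p−ε}, 0 < α ≤ α_max and 2δ^p ≤ c·α. If u_α^δ ∈ D is a Tikhonov minimizer for parameter α, then D_ζ(u_α^δ, u†) ≤ C·ð((1 + (c/2 + ρ/α_max)^{1/p})·δ^{(p−ε)/p}). -/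
/-- Theorem 3.1, rate form: convergence rate in Bregman distance
with the a-priori parameter choice `α = δ^(p-ε)`. -/
theorem bregman_rate_of_conditional_stability
    {U V : Type*} [NormedAddCommGroup U] [NormedSpace ℝ U]
    [NormedAddCommGroup V] [NormedSpace ℝ V]
    (F : U → V) (D : Set U) (hD : D.Nonempty)
    (R : U → ℝ) (hR : ∀ u, 0 ≤ R u)
    (p : ℝ) (hp : 1 ≤ p)
    (v : V) (udag : U) (hudagD : udag ∈ D) (hFudag : F udag = v)
    (δ : ℝ) (hδ : 0 < δ) (vδ : V) (hvδ : ‖vδ - v‖ ≤ δ)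
    (αmax : ℝ) (hαmax : 0 < αmax) (c : ℝ) (hc : 0 < c)
    (ρ ρ₁ : ℝ) (hρ : ρ = αmax * (c + R udag)) (hρ₁ : ρ₁ = 2 ^ (p - 1) * ρ)
    (ζ : U →L[ℝ] ℝ) (C : ℝ) (hC : 0 < C)
    (idx : ℝ → ℝ) (hidx_cont : ContinuousOn idx (Set.Ici 0))
    (hidx_mono : StrictMonoOn idx (Set.Ici 0)) (hidx_zero : idx 0 = 0)
    (hidx_nonneg : ∀ t, 0 ≤ t → 0 ≤ idx t)
    (hstab : ∀ u ∈ D, ‖F u - v‖ ^ p + αmax * R u ≤ ρ₁ →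
      R u - R udag - ζ (u - udag) ≤ C * idx ‖F u - F udag‖)
    (ε : ℝ) (hε : 0 < ε) (hεp : ε < p) (hδ1 : δ ≤ 1)
    (α : ℝ) (hαδ : α = δ ^ (p - ε))
    (hα : 0 < α) (hααmax : α ≤ αmax) (hδα : 2 * δ ^ p ≤ c * α)
    (uαδ : U) (huD : uαδ ∈ D)
    (hmin : ∀ w ∈ D, ‖F uαδ - vδ‖ ^ p + α * R uαδ ≤ ‖F w - vδ‖ ^ p + α * R w) :
    R uαδ - R udag - ζ (uαδ - udag) ≤
      C * idx ((1 + (c / 2 + ρ / αmax) ^ (1 / p)) * δ ^ ((p - ε) / p)) := by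
  have hp0 : 0 < p := by linarith
  have h1 := hmin udag hudagD
  rw [hFudag] at h1
  have hvn : ‖v - vδ‖ ≤ δ := by rw [norm_sub_rev]; exact hvδ
  have h2 : ‖v - vδ‖ ^ p ≤ δ ^ p := Real.rpow_le_rpow (norm_nonneg _) hvn hp0.le
  have htri : ‖F uαδ - v‖ ≤ ‖F uαδ - vδ‖ + δ := by
    have := norm_sub_le_norm_sub_add_norm_sub (F uαδ) vδ v
    linarith
  have hRu := hR uαδ
  have hRd := hR udag
  have ha0 : 0 ≤ ‖F uαδ - vδ‖ := norm_nonneg _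
  generalize ‖F uαδ - vδ‖ = a at *
  have hap : 0 ≤ a ^ p := Real.rpow_nonneg ha0 p
  have hdp : 0 ≤ δ ^ p := Real.rpow_nonneg hδ.le p
  have hlev : ‖F uαδ - v‖ ^ p + αmax * R uαδ ≤ ρ₁ := by
    have h3 : ‖F uαδ - v‖ ^ p ≤ (a + δ) ^ p :=
      Real.rpow_le_rpow (norm_nonneg _) htri hp0.le
    have h4 : (a + δ) ^ p ≤ 2 ^ (p - 1) * (a ^ p + δ ^ p) :=
      by exact_mod_cast NNReal.rpow_add_le_mul_rpow_add_rpow ⟨a, ha0⟩ ⟨δ, hδ.le⟩ hp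
    have h5 : (1 : ℝ) ≤ 2 ^ (p - 1) := Real.one_le_rpow (by norm_num) (by linarith)
    have h6 : a ^ p + δ ^ p + αmax * R uαδ ≤ ρ := by
      have h7 : a ^ p + δ ^ p + α * R uαδ ≤ α * (c + R udag) := by nlinarith
      have h8 : a ^ p + δ ^ p ≤ α * (c + R udag - R uαδ) := by linarith
      have h9 : 0 ≤ c + R udag - R uαδ := by
        by_contra hneg
        have := mul_neg_of_pos_of_neg hα (not_le.mp hneg)
        linarith
      have h10 := mul_le_mul_of_nonneg_right hααmax h9
      rw [hρ]
      linarith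
    have h11 : 0 ≤ αmax * R uαδ := by positivity
    have h12 := mul_le_mul_of_nonneg_left h6 (by linarith : (0 : ℝ) ≤ 2 ^ (p - 1))
    have h13 := mul_le_mul_of_nonneg_right h5 h11
    rw [hρ₁]
    linarith
  have hst := hstab uαδ huD hlev
  refine hst.trans (mul_le_mul_of_nonneg_left ?_ hC.le)
  have hρd : ρ / αmax = c + R udag := by rw [hρ]; field_simp
  have hK : 0 ≤ c / 2 + ρ / αmax := by rw [hρd]; positivity
  have hpow : α ^ (1 / p) = δ ^ ((p - ε) / p) := by
    rw [hαδ, ← Real.rpow_mul hδ.le]; congr 1; ring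
  have hd : δ ≤ δ ^ ((p - ε) / p) := by
    have := Real.rpow_le_rpow_of_exponent_ge hδ hδ1
      (show (p - ε) / p ≤ 1 by rw [div_le_one hp0]; linarith)
    rwa [Real.rpow_one] at this
  have ha : a ≤ (c / 2 + ρ / αmax) ^ (1 / p) * δ ^ ((p - ε) / p) := by
    rw [← hpow, ← Real.mul_rpow hK hα.le, one_div]
    rw [Real.le_rpow_inv_iff_of_pos ha0 (by positivity) hp0, hρd]
    have : 0 ≤ α * R uαδ := by positivity
    have : 0 ≤ α * c := by positivity
    nlinarith
  have hle : ‖F uαδ - F udag‖ ≤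
      (1 + (c / 2 + ρ / αmax) ^ (1 / p)) * δ ^ ((p - ε) / p) := by
    rw [hFudag]; linarith
  exact hidx_mono.monotoneOn (norm_nonneg _) ((norm_nonneg _).trans hle) hle
end

section
/- (Lemma 3.1) Let α_max > 0, c > 0, ρ = α_max·(c + R(u†)), ρ₁ = 2^{p−1}·ρ, and let ζ : U → ℝ be a continuous linear functional. Fix k ∈ (0,1], s ≥ 0 and a real number B such that D_ζ(u, u†) − s·‖F(u) − F(u†)‖^k ≤ B for every u ∈ M(ρ₁) (approximate Hölder stability with value at most B at s). If 0 < α ≤ α_max, 2δ^p ≤ c·α, and u_α^δ ∈ D is a Tikhonov minimizer for parameter α, then D_ζ(u_α^δ, u†) ≤ 2^k·s·δ^k + 2^k·(c/2 + ρ/α_max)^{k/p}·s·α^{k/p} + B. -/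
/-- Lemma 3.1: Bregman distance estimate via approximate Hölder
stability with value at most `B` at `s`. -/
theorem bregman_estimate_of_approximate_holder_stability
    {U V : Type*} [NormedAddCommGroup U] [NormedSpace ℝ U]
    [NormedAddCommGroup V] [NormedSpace ℝ V]
    (F : U → V) (D : Set U) (hD : D.Nonempty)
    (R : U → ℝ) (hR : ∀ u, 0 ≤ R u)
    (p : ℝ) (hp : 1 ≤ p)
    (v : V) (udag : U) (hudagD : udag ∈ D) (hFudag : F udag = v)
    (δ : ℝ) (hδ : 0 < δ) (vδ : V) (hvδ : ‖vδ - v‖ ≤ δ)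
    (αmax : ℝ) (hαmax : 0 < αmax) (c : ℝ) (hc : 0 < c)
    (ρ ρ₁ : ℝ) (hρ : ρ = αmax * (c + R udag)) (hρ₁ : ρ₁ = 2 ^ (p - 1) * ρ)
    (ζ : U →L[ℝ] ℝ)
    (k : ℝ) (hk0 : 0 < k) (hk1 : k ≤ 1)
    (s : ℝ) (hs : 0 ≤ s) (B : ℝ)
    (hB : ∀ u ∈ D, ‖F u - v‖ ^ p + αmax * R u ≤ ρ₁ →
      R u - R udag - ζ (u - udag) - s * ‖F u - F udag‖ ^ k ≤ B)
    (α : ℝ) (hα : 0 < α) (hααmax : α ≤ αmax) (hδα : 2 * δ ^ p ≤ c * α)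
    (uαδ : U) (huD : uαδ ∈ D)
    (hmin : ∀ w ∈ D, ‖F uαδ - vδ‖ ^ p + α * R uαδ ≤ ‖F w - vδ‖ ^ p + α * R w) :
    R uαδ - R udag - ζ (uαδ - udag) ≤
      2 ^ k * s * δ ^ k + 2 ^ k * (c / 2 + ρ / αmax) ^ (k / p) * s * α ^ (k / p) + B := by
  have hmu := hmin udag hudagD
  have hp0 : 0 < p := by linarith
  rw [hFudag, norm_sub_rev v vδ] at hmu
  have hvp : ‖vδ - v‖ ^ p ≤ δ ^ p := Real.rpow_le_rpow (norm_nonneg _) hvδ hp0.le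
  obtain ⟨T, hT⟩ : ∃ T, T = ‖F uαδ - vδ‖ := ⟨_, rfl⟩
  have hT0 : 0 ≤ T := hT ▸ norm_nonneg _
  rw [← hT] at hmu
  have hTp0 : 0 ≤ T ^ p := Real.rpow_nonneg hT0 _
  have hδp0 : 0 ≤ δ ^ p := Real.rpow_nonneg hδ.le _
  have htri : ‖F uαδ - v‖ ≤ T + δ := by
    have h1 := norm_sub_le_norm_sub_add_norm_sub (F uαδ) vδ v
    linarith
  have h2p : (1 : ℝ) ≤ 2 ^ (p - 1) := Real.one_le_rpow (by norm_num) (by linarith)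
  have h2k : (1 : ℝ) ≤ 2 ^ k := Real.one_le_rpow (by norm_num) hk0.le
  have hconv : ‖F uαδ - v‖ ^ p ≤ 2 ^ (p - 1) * (T ^ p + δ ^ p) :=
    (Real.rpow_le_rpow (norm_nonneg _) htri hp0.le).trans
      (by exact_mod_cast NNReal.rpow_add_le_mul_rpow_add_rpow ⟨T, hT0⟩ ⟨δ, hδ.le⟩ hp)
  have hRu := hR uαδ
  have hRd := hR udag
  have hmem : T ^ p + δ ^ p + αmax * R uαδ ≤ ρ := by
    have h3 : α * (T ^ p + δ ^ p + αmax * R uαδ) ≤ α * ρ := by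
      have e1 : α * T ^ p ≤ αmax * T ^ p := mul_le_mul_of_nonneg_right hααmax hTp0
      have e2 : α * δ ^ p ≤ αmax * δ ^ p := mul_le_mul_of_nonneg_right hααmax hδp0
      have e3 : αmax * (T ^ p + α * R uαδ) ≤ αmax * (δ ^ p + α * R udag) :=
        mul_le_mul_of_nonneg_left (by linarith) hαmax.le
      have e4 : αmax * (2 * δ ^ p) ≤ αmax * (c * α) :=
        mul_le_mul_of_nonneg_left hδα hαmax.le
      rw [hρ]
      linarith
    exact le_of_mul_le_mul_left h3 hα
  have hlev : ‖F uαδ - v‖ ^ p + αmax * R uαδ ≤ ρ₁ := by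
    have e1 : αmax * R uαδ ≤ 2 ^ (p - 1) * (αmax * R uαδ) :=
      le_mul_of_one_le_left (by positivity) h2p
    have e2 := mul_le_mul_of_nonneg_left hmem (by linarith : (0:ℝ) ≤ 2 ^ (p - 1))
    rw [hρ₁]
    linarith
  have hmain := hB uαδ huD hlev
  rw [hFudag] at hmain
  have hk : ‖F uαδ - v‖ ^ k ≤ T ^ k + δ ^ k :=
    (Real.rpow_le_rpow (norm_nonneg _) htri hk0.le).trans
      (Real.rpow_add_le_add_rpow hT0 hδ.le hk0.le hk1)
  have hq : ρ / αmax = c + R udag := by rw [hρ]; field_simp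
  rw [hq]
  have hTb : T ^ p ≤ (c / 2 + (c + R udag)) * α := by
    have := mul_nonneg hα.le hRu
    have := mul_pos hc hα
    linarith
  have hTk : T ^ k ≤ (c / 2 + (c + R udag)) ^ (k / p) * α ^ (k / p) := by
    rw [← Real.mul_rpow (by positivity) hα.le]
    have h5 := Real.rpow_le_rpow hTp0 hTb (by positivity : 0 ≤ k / p)
    rwa [← Real.rpow_mul hT0, mul_div_cancel₀ _ hp0.ne'] at h5
  have hTk0 : 0 ≤ T ^ k := Real.rpow_nonneg hT0 _
  have hδk0 : 0 ≤ δ ^ k := Real.rpow_nonneg hδ.le _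
  generalize (c / 2 + (c + R udag)) ^ (k / p) = A at *
  generalize α ^ (k / p) = E at *
  have f1 : s * ‖F uαδ - v‖ ^ k ≤ s * (A * E + δ ^ k) :=
    mul_le_mul_of_nonneg_left (by linarith) hs
  have f2 : s * (A * E + δ ^ k) ≤ 2 ^ k * (s * (A * E + δ ^ k)) :=
    le_mul_of_one_le_left (mul_nonneg hs (by linarith)) h2k
  linarith
end

section
/- (Theorem 3.2) Let α_max > 0, c > 0, ρ = α_max·(c + R(u†)), ρ₁ = 2^{p−1}·ρ, ζ : U → ℝ a continuous linear functional, k ∈ (0,1] and 0 < t < k. Let s > 0 and B > 0 satisfy s·δ^t = B and D_ζ(u, u†) − s·‖F(u) − F(u†)‖^k ≤ B for every u ∈ M(ρ₁). Suppose α = δ^{p·t/k}, 0 < α ≤ α_max, 2δ^p ≤ c·α, and δ^{k−t} ≤ c₁ for a constant c₁ > 0. If u_α^δ ∈ D is a Tikhonov minimizer for parameter α, then D_ζ(u_α^δ, u†) ≤ (2^k·c₁ + 2^k·(c/2 + ρ/α_max)^{k/p} + 1)·B. -/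
/-- Theorem 3.2: convergence rate via approximate Hölder
stability estimates with the parameter choice `α = δ^(p·t/k)`. -/
theorem bregman_rate_of_approximate_holder_stability
    {U V : Type*} [NormedAddCommGroup U] [NormedSpace ℝ U]
    [NormedAddCommGroup V] [NormedSpace ℝ V]
    (F : U → V) (D : Set U) (hD : D.Nonempty)
    (R : U → ℝ) (hR : ∀ u, 0 ≤ R u)
    (p : ℝ) (hp : 1 ≤ p)
    (v : V) (udag : U) (hudagD : udag ∈ D) (hFudag : F udag = v)
    (δ : ℝ) (hδ : 0 < δ) (vδ : V) (hvδ : ‖vδ - v‖ ≤ δ)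
    (αmax : ℝ) (hαmax : 0 < αmax) (c : ℝ) (hc : 0 < c)
    (ρ ρ₁ : ℝ) (hρ : ρ = αmax * (c + R udag)) (hρ₁ : ρ₁ = 2 ^ (p - 1) * ρ)
    (ζ : U →L[ℝ] ℝ)
    (k : ℝ) (hk0 : 0 < k) (hk1 : k ≤ 1)
    (t : ℝ) (ht0 : 0 < t) (htk : t < k)
    (s B : ℝ) (hs : 0 < s) (hBpos : 0 < B) (hsB : s * δ ^ t = B)
    (hB : ∀ u ∈ D, ‖F u - v‖ ^ p + αmax * R u ≤ ρ₁ →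
      R u - R udag - ζ (u - udag) - s * ‖F u - F udag‖ ^ k ≤ B)
    (α : ℝ) (hαδ : α = δ ^ (p * t / k))
    (hα : 0 < α) (hααmax : α ≤ αmax) (hδα : 2 * δ ^ p ≤ c * α)
    (c₁ : ℝ) (hc₁ : 0 < c₁) (hδc₁ : δ ^ (k - t) ≤ c₁)
    (uαδ : U) (huD : uαδ ∈ D)
    (hmin : ∀ w ∈ D, ‖F uαδ - vδ‖ ^ p + α * R uαδ ≤ ‖F w - vδ‖ ^ p + α * R w) :
    R uαδ - R udag - ζ (uαδ - udag) ≤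
      (2 ^ k * c₁ + 2 ^ k * (c / 2 + ρ / αmax) ^ (k / p) + 1) * B := by
  have hp0 : 0 < p := by linarith
  set a := ‖F uαδ - vδ‖ with ha
  have ha0 : 0 ≤ a := norm_nonneg _
  have hδp : 0 < δ ^ p := Real.rpow_pos_of_pos hδ p
  have hap0 : 0 ≤ a ^ p := Real.rpow_nonneg ha0 p
  have h1 : a ^ p + α * R uαδ ≤ δ ^ p + α * R udag := by
    refine (hmin udag hudagD).trans ?_
    have : ‖F udag - vδ‖ ^ p ≤ δ ^ p := by
      apply Real.rpow_le_rpow (norm_nonneg _) _ hp0.le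
      rw [hFudag, norm_sub_rev]; exact hvδ
    linarith
  have h2 : ‖F uαδ - v‖ ≤ a + δ := by
    calc ‖F uαδ - v‖ = ‖(F uαδ - vδ) + (vδ - v)‖ := by congr 1; abel
      _ ≤ _ := (norm_add_le _ _).trans (by linarith)
  have h3 : ‖F uαδ - v‖ ^ p ≤ 2 ^ (p - 1) * (a ^ p + δ ^ p) :=
    (Real.rpow_le_rpow (norm_nonneg _) h2 hp0.le).trans
      (by
        have := NNReal.rpow_add_le_mul_rpow_add_rpow ⟨a, ha0⟩ ⟨δ, hδ.le⟩ hp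
        exact_mod_cast this)
  have h2p : (1 : ℝ) ≤ 2 ^ (p - 1) := Real.one_le_rpow (by norm_num) (by linarith)
  have hRu := hR uαδ
  have hRd := hR udag
  have h4 : a ^ p + δ ^ p + αmax * R uαδ ≤ ρ := by
    have e1 : α * (a ^ p + δ ^ p + αmax * R uαδ) ≤ α * ρ := by
      rw [hρ]
      have q1 : α * a ^ p ≤ αmax * a ^ p := by gcongr
      have q2 : α * δ ^ p ≤ αmax * δ ^ p := by gcongr
      have q3 := mul_le_mul_of_nonneg_left h1 hαmax.le
      have q4 := mul_le_mul_of_nonneg_left hδα hαmax.le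
      nlinarith
    exact le_of_mul_le_mul_left e1 hα
  have hmem := hB uαδ huD (by
    rw [hρ₁]
    have q1 := mul_le_mul_of_nonneg_left h4 (by linarith : (0:ℝ) ≤ 2 ^ (p - 1))
    have q2 : 1 * (αmax * R uαδ) ≤ 2 ^ (p - 1) * (αmax * R uαδ) := by gcongr
    linarith)
  rw [hFudag] at hmem
  set C := c / 2 + ρ / αmax with hC
  have hCe : C = c / 2 + (c + R udag) := by
    rw [hC, hρ]; field_simp
  have hC0 : 0 ≤ C := by rw [hCe]; positivity
  have h5 : a ^ p ≤ α * C := by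
    rw [hCe]
    have := mul_nonneg hα.le hRu
    have := mul_pos hα hc
    nlinarith
  have h6 : a ^ k ≤ δ ^ t * C ^ (k / p) := by
    have := Real.rpow_le_rpow hap0 h5 (div_pos hk0 hp0).le
    rw [← Real.rpow_mul ha0, Real.mul_rpow hα.le hC0, hαδ, ← Real.rpow_mul hδ.le,
      show p * (k / p) = k by field_simp, show p * t / k * (k / p) = t by field_simp] at this
    exact this
  have h7 : ‖F uαδ - v‖ ^ k ≤ a ^ k + δ ^ k :=
    (Real.rpow_le_rpow (norm_nonneg _) h2 hk0.le).trans
      (by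
        have := NNReal.rpow_add_le_add_rpow ⟨a, ha0⟩ ⟨δ, hδ.le⟩ hk0.le hk1
        exact_mod_cast this)
  have h8 : δ ^ k ≤ δ ^ t * c₁ := by
    calc δ ^ k = δ ^ t * δ ^ (k - t) := by rw [← Real.rpow_add hδ]; congr 1; ring
      _ ≤ _ := by gcongr
  have h9 : s * ‖F uαδ - v‖ ^ k ≤ B * (c₁ + C ^ (k / p)) := by
    rw [← hsB, mul_assoc]
    apply mul_le_mul_of_nonneg_left _ hs.le
    linarith
  have h2k : (1 : ℝ) ≤ 2 ^ k := Real.one_le_rpow (by norm_num) hk0.le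
  have hCk : 0 ≤ C ^ (k / p) := Real.rpow_nonneg hC0 _
  have h10 : 1 * (B * (c₁ + C ^ (k / p))) ≤ 2 ^ k * (B * (c₁ + C ^ (k / p))) := by gcongr
  linarith
end

section
/- (Theorem 3.3) Let u₀ ∈ U with ‖u₀ − u†‖ ≤ K₁ for some K₁ > 0, let c > 0 and α > 0 satisfy δ^p ≤ c·α, and let η be a seminorm on U (a weaker norm). Assume there are constants C > 0 and M ≥ (c + K₁^p)^{1/p} + K₁ and an index function ð such that the conditional stability estimate η(u₁ − u₂) ≤ C·ð(‖F(u₁) − F(u₂)‖) holds for all u₁, u₂ ∈ D(F) with ‖u₁ − u₂‖ ≤ M. If u_α^δ ∈ D(F) minimizes u ↦ ‖F(u) − v^δ‖^p + α·‖u − u₀‖^p over D(F), then η(u_α^δ − u†) ≤ C·ð(α^{1/p}·(c + K₁^p)^{1/p} + δ); in particular, if moreover α = δ^{p−ε} with 0 < ε < p and δ ≤ 1, then η(u_α^δ − u†) ≤ C·ð((1 + (c + K₁^p)^{1/p})·δ^{(p−ε)/p}). -/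
/-- Theorem 3.3: convergence rates in a weaker (semi)norm via
conditional stability estimates. -/
theorem weaker_norm_rate_of_conditional_stability
    {U V : Type*} [NormedAddCommGroup U] [NormedSpace ℝ U]
    [NormedAddCommGroup V] [NormedSpace ℝ V]
    (F : U → V) (DF : Set U) (hDF : DF.Nonempty)
    (p : ℝ) (hp : 1 ≤ p)
    (v : V) (udag : U) (hudagD : udag ∈ DF) (hFudag : F udag = v)
    (δ : ℝ) (hδ : 0 < δ) (vδ : V) (hvδ : ‖vδ - v‖ ≤ δ)
    (u₀ : U) (K₁ : ℝ) (hK₁ : 0 < K₁) (hu₀ : ‖u₀ - udag‖ ≤ K₁)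
    (c : ℝ) (hc : 0 < c) (α : ℝ) (hα : 0 < α) (hδα : δ ^ p ≤ c * α)
    (η : U → ℝ) (hη_nonneg : ∀ x, 0 ≤ η x)
    (hη_add : ∀ x y, η (x + y) ≤ η x + η y)
    (hη_smul : ∀ (a : ℝ) (x : U), η (a • x) = |a| * η x)
    (C : ℝ) (hC : 0 < C)
    (M : ℝ) (hM : (c + K₁ ^ p) ^ (1 / p) + K₁ ≤ M)
    (idx : ℝ → ℝ) (hidx_cont : ContinuousOn idx (Set.Ici 0))
    (hidx_mono : StrictMonoOn idx (Set.Ici 0)) (hidx_zero : idx 0 = 0)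
    (hidx_nonneg : ∀ t, 0 ≤ t → 0 ≤ idx t)
    (hstab : ∀ u₁ ∈ DF, ∀ u₂ ∈ DF, ‖u₁ - u₂‖ ≤ M →
      η (u₁ - u₂) ≤ C * idx ‖F u₁ - F u₂‖)
    (uαδ : U) (huD : uαδ ∈ DF)
    (hmin : ∀ w ∈ DF, ‖F uαδ - vδ‖ ^ p + α * ‖uαδ - u₀‖ ^ p ≤
      ‖F w - vδ‖ ^ p + α * ‖w - u₀‖ ^ p) :
    η (uαδ - udag) ≤ C * idx (α ^ (1 / p) * (c + K₁ ^ p) ^ (1 / p) + δ) ∧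
    (∀ ε : ℝ, 0 < ε → ε < p → α = δ ^ (p - ε) → δ ≤ 1 →
      η (uαδ - udag) ≤ C * idx ((1 + (c + K₁ ^ p) ^ (1 / p)) * δ ^ ((p - ε) / p))) := by
  have hp0 : 0 < p := by linarith
  have hKp : 0 < K₁ ^ p := Real.rpow_pos_of_pos hK₁ p
  have hS : 0 < c + K₁ ^ p := by linarith
  have h1 : ‖F udag - vδ‖ ^ p ≤ c * α := by
    refine le_trans (Real.rpow_le_rpow (norm_nonneg _) ?_ hp0.le) hδα
    rw [hFudag, norm_sub_rev]; exact hvδ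
  have h2 : ‖udag - u₀‖ ^ p ≤ K₁ ^ p := by
    refine Real.rpow_le_rpow (norm_nonneg _) ?_ hp0.le
    rw [norm_sub_rev]; exact hu₀
  have h3 := hmin udag hudagD
  have h4 : α * ‖udag - u₀‖ ^ p ≤ α * K₁ ^ p := mul_le_mul_of_nonneg_left h2 hα.le
  have hn1 : 0 ≤ ‖F uαδ - vδ‖ ^ p := Real.rpow_nonneg (norm_nonneg _) p
  have hn2 : 0 ≤ ‖uαδ - u₀‖ ^ p := Real.rpow_nonneg (norm_nonneg _) p
  have h5 : ‖F uαδ - vδ‖ ^ p ≤ α * (c + K₁ ^ p) := by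
    have := mul_nonneg hα.le hn2
    linarith
  have h6 : ‖uαδ - u₀‖ ^ p ≤ c + K₁ ^ p := by
    have : α * ‖uαδ - u₀‖ ^ p ≤ α * (c + K₁ ^ p) := by linarith
    exact le_of_mul_le_mul_left this hα
  have root : ∀ x y : ℝ, 0 ≤ x → x ^ p ≤ y → x ≤ y ^ (1 / p) := by
    intro x y hx hxy
    have := Real.rpow_le_rpow (Real.rpow_nonneg hx p) hxy (one_div_pos.mpr hp0).le
    rwa [← Real.rpow_mul hx, mul_one_div_cancel hp0.ne', Real.rpow_one] at this
  have h7 := root _ _ (norm_nonneg _) h5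
  have h8 := root _ _ (norm_nonneg _) h6
  rw [Real.mul_rpow hα.le hS.le] at h7
  have h9 : ‖uαδ - udag‖ ≤ M := by
    have := norm_sub_le_norm_sub_add_norm_sub uαδ u₀ udag
    linarith
  have h10 : ‖F uαδ - F udag‖ ≤ α ^ (1 / p) * (c + K₁ ^ p) ^ (1 / p) + δ := by
    have := norm_sub_le_norm_sub_add_norm_sub (F uαδ) vδ (F udag)
    rw [hFudag] at this ⊢
    linarith
  have h11 := hstab _ huD _ hudagD h9
  have key : ∀ t, ‖F uαδ - F udag‖ ≤ t → η (uαδ - udag) ≤ C * idx t := by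
    intro t ht
    refine h11.trans (mul_le_mul_of_nonneg_left ?_ hC.le)
    exact hidx_mono.monotoneOn (norm_nonneg _) ((norm_nonneg _).trans ht) ht
  refine ⟨key _ h10, ?_⟩
  intro ε hε hεp hαε hδ1
  apply key
  refine h10.trans ?_
  have e1 : α ^ (1 / p) = δ ^ ((p - ε) / p) := by
    rw [hαε, ← Real.rpow_mul hδ.le, mul_one_div]
  have e2 : δ ≤ δ ^ ((p - ε) / p) := by
    have := Real.rpow_le_rpow_of_exponent_ge hδ hδ1
      (show (p - ε) / p ≤ 1 by rw [div_le_one hp0]; linarith)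
    rwa [Real.rpow_one] at this
  rw [e1]
  linarith
end

section
/- (Proposition 3.1, part (iv)) Fix k ∈ (0,1], a subset M ⊆ U with u† ∈ M, and a continuous linear functional ζ : U → ℝ, and for s ≥ 0 define 𝒟(s) = sup_{u ∈ M} (D_ζ(u, u†) − s·‖F(u) − F(u†)‖^k), where for every s ≥ 0 this supremum is attained by some element of M. If 𝒟(s) > 0 for every s ≥ 0 and 𝒟(s) → 0 as s → ∞, then 𝒟 is strictly monotonically decreasing: 𝒟(s₂) < 𝒟(s₁) whenever 0 ≤ s₁ < s₂. -/
/-- Proposition 3.1, part (iv): if the distance function of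
approximate Hölder stability is everywhere positive, its supremum is attained,
and it tends to zero at infinity, then it is strictly decreasing. -/
theorem approx_holder_distance_strict_anti
    {U V : Type*} [NormedAddCommGroup U] [NormedSpace ℝ U]
    [NormedAddCommGroup V] [NormedSpace ℝ V]
    (F : U → V) (R : U → ℝ) (hR : ∀ u, 0 ≤ R u)
    (udag : U) (M : Set U) (hudagM : udag ∈ M)
    (ζ : U →L[ℝ] ℝ)
    (k : ℝ) (hk0 : 0 < k) (hk1 : k ≤ 1)
    (𝒟 : ℝ → ℝ)
    (hattained : ∀ s : ℝ, 0 ≤ s → ∃ u ∈ M,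
      R u - R udag - ζ (u - udag) - s * ‖F u - F udag‖ ^ k = 𝒟 s)
    (hub : ∀ s : ℝ, 0 ≤ s → ∀ u ∈ M,
      R u - R udag - ζ (u - udag) - s * ‖F u - F udag‖ ^ k ≤ 𝒟 s)
    (hpos : ∀ s : ℝ, 0 ≤ s → 0 < 𝒟 s)
    (hlim : Filter.Tendsto 𝒟 Filter.atTop (nhds 0)) :
    ∀ s₁ s₂ : ℝ, 0 ≤ s₁ → s₁ < s₂ → 𝒟 s₂ < 𝒟 s₁ := by
  intro s₁ s₂ h1 h12
  have h2 : 0 ≤ s₂ := h1.trans h12.le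
  obtain ⟨u, hu, he⟩ := hattained s₂ h2
  have ht : 0 ≤ ‖F u - F udag‖ ^ k := Real.rpow_nonneg (norm_nonneg _) k
  rcases ht.eq_or_lt with h0 | h0
  · exfalso
    have hle : 𝒟 s₂ ≤ 0 := by
      refine ge_of_tendsto hlim ?_
      filter_upwards [Filter.eventually_ge_atTop (0 : ℝ)] with s hs
      have h := hub s hs u hu
      rw [← h0] at h he
      linarith
    exact absurd (hpos s₂ h2) (not_lt.mpr hle)
  · have h := hub s₁ h1 u hu
    have h3 := mul_lt_mul_of_pos_right h12 h0
    linarith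
end

section
/- (Corollary 4.1 (i)) Let α_max > 0, c > 0, ρ₁ = 2^{p−1}·α_max·(c + R(u†)), and let ζ : U → ℝ be a continuous linear functional, β₁ ∈ [0,1), β₂ ≥ 0, and ð an index function such that the variational inequality β₁·D_ζ(u, u†) + β₂·ð(‖F(u) − F(u†)‖) ≥ ζ(u† − u) holds for all u ∈ M(ρ₁). If 0 < α ≤ α_max and u_α ∈ D minimizes w ↦ ‖F(w) − v‖^p + α·R(w) over D (noiseless Tikhonov minimizer), then D_ζ(u_α, u†) ≤ (β₂/(1 − β₁))·ð(‖F(u_α) − F(u†)‖). -/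
/-- Corollary 4.1 (i): in the noiseless case, a variational
inequality on the level set implies the conditional stability estimate for
Tikhonov minimizers. -/
theorem noiseless_conditional_stability_of_variational_inequality
    {U V : Type*} [NormedAddCommGroup U] [NormedSpace ℝ U]
    [NormedAddCommGroup V] [NormedSpace ℝ V]
    (F : U → V) (D : Set U) (hD : D.Nonempty)
    (R : U → ℝ) (hR : ∀ u, 0 ≤ R u)
    (p : ℝ) (hp : 1 ≤ p)
    (v : V) (udag : U) (hudagD : udag ∈ D) (hFudag : F udag = v)
    (αmax : ℝ) (hαmax : 0 < αmax) (c : ℝ) (hc : 0 < c)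
    (ρ₁ : ℝ) (hρ₁ : ρ₁ = 2 ^ (p - 1) * αmax * (c + R udag))
    (ζ : U →L[ℝ] ℝ)
    (β₁ : ℝ) (hβ₁0 : 0 ≤ β₁) (hβ₁1 : β₁ < 1)
    (β₂ : ℝ) (hβ₂ : 0 ≤ β₂)
    (idx : ℝ → ℝ) (hidx_cont : ContinuousOn idx (Set.Ici 0))
    (hidx_mono : StrictMonoOn idx (Set.Ici 0)) (hidx_zero : idx 0 = 0)
    (hidx_nonneg : ∀ t, 0 ≤ t → 0 ≤ idx t)
    (hvi : ∀ u ∈ D, ‖F u - v‖ ^ p + αmax * R u ≤ ρ₁ →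
      ζ (udag - u) ≤
        β₁ * (R u - R udag - ζ (u - udag)) + β₂ * idx ‖F u - F udag‖)
    (α : ℝ) (hα : 0 < α) (hααmax : α ≤ αmax)
    (uα : U) (huD : uα ∈ D)
    (hmin : ∀ w ∈ D, ‖F uα - v‖ ^ p + α * R uα ≤ ‖F w - v‖ ^ p + α * R w) :
    R uα - R udag - ζ (uα - udag) ≤ β₂ / (1 - β₁) * idx ‖F uα - F udag‖ := by
  have h0 := hmin udag hudagD
  have hz : ‖F udag - v‖ ^ p = 0 := by
    rw [hFudag, sub_self, norm_zero, Real.zero_rpow (by linarith)]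
  rw [hz, zero_add] at h0
  have hn : 0 ≤ ‖F uα - v‖ ^ p := Real.rpow_nonneg (norm_nonneg _) p
  have hRle : R uα ≤ R udag := le_of_mul_le_mul_left (by linarith) hα
  have h1 : ‖F uα - v‖ ^ p + αmax * R uα ≤ αmax * R udag := by
    nlinarith [mul_nonneg (sub_nonneg.2 hααmax) (sub_nonneg.2 hRle)]
  have h2 : (1 : ℝ) ≤ 2 ^ (p - 1) := Real.one_le_rpow (by norm_num) (by linarith)
  have h3 : αmax * R udag ≤ ρ₁ := by
    have hA : 0 ≤ αmax * (c + R udag) := mul_nonneg hαmax.le (by linarith [hR udag])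
    rw [hρ₁, mul_assoc]
    nlinarith [mul_nonneg (sub_nonneg.2 h2) hA, mul_pos hαmax hc]
  have h4 := hvi uα huD (h1.trans h3)
  have h5 : ζ (udag - uα) = - ζ (uα - udag) := by rw [← map_neg, neg_sub]
  rw [div_mul_eq_mul_div, le_div_iff₀ (by linarith)]
  rw [h5] at h4
  linarith
end

section
/- (Remark 3.3, Hölder stability from a derivative lower bound) Let r ∈ (0,1], ε ∈ (0,1], L ≥ 0 and A > L/2. Assume: (nonlinearity condition) ‖F(u') − F(u) − F'(u)(u' − u)‖ ≤ (L/2)·‖u' − u‖² for all u, u' ∈ D(F), and (derivative lower bound) ‖F'(u)(u − u†)‖ ≥ A·‖u − u†‖^{2−ε} for all u ∈ D(F) ∩ B_r(u†). Then for every u ∈ D(F) ∩ B_r(u†): ‖u − u†‖ ≤ ((A − L/2)^{−1}·‖F(u) − F(u†)‖)^{1/(2−ε)}. -/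
/-- Remark 3.3: Hölder stability from a lower bound on the
derivative together with the Taylor-type nonlinearity condition. -/
theorem holder_stability_of_derivative_lower_bound
    {U V : Type*} [NormedAddCommGroup U] [NormedSpace ℝ U]
    [NormedAddCommGroup V] [NormedSpace ℝ V]
    (F : U → V) (DF : Set U) (udag : U) (hudagD : udag ∈ DF)
    (F' : U → (U →L[ℝ] V))
    (r : ℝ) (hr0 : 0 < r) (hr1 : r ≤ 1)
    (ε : ℝ) (hε0 : 0 < ε) (hε1 : ε ≤ 1)
    (L : ℝ) (hL : 0 ≤ L)
    (A : ℝ) (hA : L / 2 < A)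
    (hnonlin : ∀ u ∈ DF, ∀ u' ∈ DF,
      ‖F u' - F u - F' u (u' - u)‖ ≤ L / 2 * ‖u' - u‖ ^ (2 : ℝ))
    (hlower : ∀ u ∈ DF, ‖u - udag‖ < r →
      A * ‖u - udag‖ ^ (2 - ε) ≤ ‖F' u (u - udag)‖) :
    ∀ u ∈ DF, ‖u - udag‖ < r →
      ‖u - udag‖ ≤ ((A - L / 2)⁻¹ * ‖F u - F udag‖) ^ (1 / (2 - ε)) := by
  intro u hu hur
  have h1 := hnonlin u hu udag hudagD
  have h2 := hlower u hu hur
  have hp : 0 < 2 - ε := by linarith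
  have ht0 : 0 ≤ ‖u - udag‖ := norm_nonneg _
  have h3 : ‖u - udag‖ ^ (2 : ℝ) ≤ ‖u - udag‖ ^ (2 - ε) :=
    Real.rpow_le_rpow_of_exponent_ge' ht0 (by linarith) hp.le (by linarith)
  rw [norm_sub_rev udag u] at h1
  have h4 : F' u (u - udag) =
      (F u - F udag) + (F udag - F u - F' u (udag - u)) := by
    rw [← neg_sub u udag, map_neg]
    abel
  have h5 : ‖F' u (u - udag)‖ ≤
      ‖F u - F udag‖ + ‖F udag - F u - F' u (udag - u)‖ := by
    conv_lhs => rw [h4]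
    exact norm_add_le _ _
  have h6 := mul_le_mul_of_nonneg_left h3 (by linarith : 0 ≤ L / 2)
  have hA' : 0 < A - L / 2 := by linarith
  have h7 : ‖u - udag‖ ^ (2 - ε) ≤ (A - L / 2)⁻¹ * ‖F u - F udag‖ := by
    rw [le_inv_mul_iff₀ hA']
    linarith
  have h8 := Real.rpow_le_rpow (Real.rpow_nonneg ht0 _) h7
    (by positivity : 0 ≤ 1 / (2 - ε))
  rwa [← Real.rpow_mul ht0, mul_one_div_cancel hp.ne', Real.rpow_one] at h8
end

section
/- (Theorem 6.1, norm convergence rate for q > 1) Let α_max > 0, c > 0, ρ = α_max·(c + R(u†)), ρ₁ = 2^{p−1}·ρ, let ζ : U → ℝ be a continuous linear functional, C > 0 a constant and ð an index function such that D_ζ(u, u†) ≤ C·ð(‖F(u) − F(u†)‖) for every u ∈ M(ρ₁). Assume moreover there is a constant K₁ > 0 with ‖u − u†‖² ≤ K₁·D_ζ(u, u†) for every u ∈ M(ρ₁) (as holds for the sparsity penalty with exponent q > 1). If 0 < α ≤ α_max, 2δ^p ≤ c·α, and u_α^δ ∈ D is a Tikhonov minimizer for parameter α, then ‖u_α^δ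 − u†‖ ≤ (K₁·C·ð(α^{1/p}·(c/2 + ρ/α_max)^{1/p} + δ))^{1/2}. -/
/-- Theorem 6.1, norm convergence rate for q > 1. -/
theorem norm_rate_of_conditional_stability_sparsity
    {U V : Type*} [NormedAddCommGroup U] [NormedSpace ℝ U]
    [NormedAddCommGroup V] [NormedSpace ℝ V]
    (F : U → V) (D : Set U) (hD : D.Nonempty)
    (R : U → ℝ) (hR : ∀ u, 0 ≤ R u)
    (p : ℝ) (hp : 1 ≤ p)
    (v : V) (udag : U) (hudagD : udag ∈ D) (hFudag : F udag = v)
    (δ : ℝ) (hδ : 0 < δ) (vδ : V) (hvδ : ‖vδ - v‖ ≤ δ)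
    (αmax : ℝ) (hαmax : 0 < αmax) (c : ℝ) (hc : 0 < c)
    (ρ ρ₁ : ℝ) (hρ : ρ = αmax * (c + R udag)) (hρ₁ : ρ₁ = 2 ^ (p - 1) * ρ)
    (ζ : U →L[ℝ] ℝ) (C : ℝ) (hC : 0 < C)
    (idx : ℝ → ℝ) (hidx_cont : ContinuousOn idx (Set.Ici 0))
    (hidx_mono : StrictMonoOn idx (Set.Ici 0)) (hidx_zero : idx 0 = 0)
    (hidx_nonneg : ∀ t, 0 ≤ t → 0 ≤ idx t)
    (hstab : ∀ u ∈ D, ‖F u - v‖ ^ p + αmax * R u ≤ ρ₁ →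
      R u - R udag - ζ (u - udag) ≤ C * idx ‖F u - F udag‖)
    (K₁ : ℝ) (hK₁ : 0 < K₁)
    (hnorm_bregman : ∀ u ∈ D, ‖F u - v‖ ^ p + αmax * R u ≤ ρ₁ →
      ‖u - udag‖ ^ (2 : ℝ) ≤ K₁ * (R u - R udag - ζ (u - udag)))
    (α : ℝ) (hα : 0 < α) (hααmax : α ≤ αmax) (hδα : 2 * δ ^ p ≤ c * α)
    (uαδ : U) (huD : uαδ ∈ D)
    (hmin : ∀ w ∈ D, ‖F uαδ - vδ‖ ^ p + α * R uαδ ≤ ‖F w - vδ‖ ^ p + α * R w) :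
    ‖uαδ - udag‖ ≤
      (K₁ * (C * idx (α ^ (1 / p) * (c / 2 + ρ / αmax) ^ (1 / p) + δ))) ^ (1 / (2 : ℝ)) := by
  have hp0 : 0 < p := by linarith
  have h1 := hmin udag hudagD
  have hd : ‖F udag - vδ‖ ^ p ≤ δ ^ p := by
    rw [hFudag, norm_sub_rev]
    exact Real.rpow_le_rpow (norm_nonneg _) hvδ hp0.le
  have ha0 : 0 ≤ ‖F uαδ - vδ‖ := norm_nonneg _
  have hap : 0 ≤ ‖F uαδ - vδ‖ ^ p := Real.rpow_nonneg ha0 p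
  have hRu := hR uαδ
  have hRd := hR udag
  have htri : ‖F uαδ - v‖ ≤ ‖F uαδ - vδ‖ + δ := by
    have := norm_sub_le_norm_sub_add_norm_sub (F uαδ) vδ v
    linarith
  have hRle : R uαδ ≤ c / 2 + R udag := by
    have : α * R uαδ ≤ α * (c / 2 + R udag) := by nlinarith
    exact le_of_mul_le_mul_left this hα
  have hm : (1 : ℝ) ≤ 2 ^ (p - 1) := Real.one_le_rpow (by norm_num) (by linarith)
  have hpow : ‖F uαδ - v‖ ^ p ≤ 2 ^ (p - 1) * (‖F uαδ - vδ‖ ^ p + δ ^ p) :=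
    (Real.rpow_le_rpow (norm_nonneg _) htri hp0.le).trans
      (by exact_mod_cast NNReal.rpow_add_le_mul_rpow_add_rpow ⟨_, ha0⟩ ⟨δ, hδ.le⟩ hp)
  have hlev : ‖F uαδ - v‖ ^ p + αmax * R uαδ ≤ ρ₁ := by
    rw [hρ₁, hρ]
    generalize (2 : ℝ) ^ (p - 1) = m at *
    have e1 : ‖F uαδ - vδ‖ ^ p + δ ^ p ≤ αmax * (c + R udag - R uαδ) := by
      have : α * (c + R udag - R uαδ) ≤ αmax * (c + R udag - R uαδ) :=
        mul_le_mul_of_nonneg_right hααmax (by linarith)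
      linarith
    have e2 := mul_le_mul_of_nonneg_left e1 (by linarith : 0 ≤ m)
    have e3 : 1 * (αmax * R uαδ) ≤ m * (αmax * R uαδ) :=
      mul_le_mul_of_nonneg_right hm (by positivity)
    linarith
  have hs := hstab uαδ huD hlev
  have hn := hnorm_bregman uαδ huD hlev
  have hq : ρ / αmax = c + R udag := by rw [hρ]; field_simp
  have hbound : ‖F uαδ - vδ‖ ≤ α ^ (1 / p) * (c / 2 + ρ / αmax) ^ (1 / p) := by
    rw [hq, ← Real.mul_rpow hα.le (by positivity), one_div]
    rw [Real.le_rpow_inv_iff_of_pos ha0 (by positivity) hp0]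
    have : 0 ≤ α * R uαδ := by positivity
    have : 0 ≤ c * α := by positivity
    linarith
  have hmono : idx ‖F uαδ - F udag‖
      ≤ idx (α ^ (1 / p) * (c / 2 + ρ / αmax) ^ (1 / p) + δ) := by
    have hle : ‖F uαδ - F udag‖ ≤ α ^ (1 / p) * (c / 2 + ρ / αmax) ^ (1 / p) + δ := by
      rw [hFudag]; linarith
    exact hidx_mono.monotoneOn (norm_nonneg _) ((norm_nonneg _).trans hle) hle
  have hfin : ‖uαδ - udag‖ ^ (2 : ℝ)
      ≤ K₁ * (C * idx (α ^ (1 / p) * (c / 2 + ρ / αmax) ^ (1 / p) + δ)) :=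
    hn.trans (mul_le_mul_of_nonneg_left
      (hs.trans (mul_le_mul_of_nonneg_left hmono hC.le)) hK₁.le)
  rw [one_div (2 : ℝ), Real.le_rpow_inv_iff_of_pos (norm_nonneg _)
    ((Real.rpow_nonneg (norm_nonneg _) _).trans hfin) (by norm_num)]
  exact hfin
end

section
/- (Residual convergence rate, part of (6.1)) Let c > 0, 0 < ε < p, and suppose α = δ^{p−ε} satisfies 2δ^p ≤ c·α. If u_α^δ ∈ D is a Tikhonov minimizer for parameter α, then ‖F(u_α^δ) − v^δ‖ ≤ (c/2 + R(u†))^{1/p}·δ^{(p−ε)/p}. -/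
/-- Residual convergence rate, part of (6.1). -/
theorem residual_rate_of_tikhonov_minimizer
    {U V : Type*} [NormedAddCommGroup U] [NormedSpace ℝ U]
    [NormedAddCommGroup V] [NormedSpace ℝ V]
    (F : U → V) (D : Set U) (hD : D.Nonempty)
    (R : U → ℝ) (hR : ∀ u, 0 ≤ R u)
    (p : ℝ) (hp : 1 ≤ p)
    (v : V) (udag : U) (hudagD : udag ∈ D) (hFudag : F udag = v)
    (δ : ℝ) (hδ : 0 < δ) (vδ : V) (hvδ : ‖vδ - v‖ ≤ δ)
    (c : ℝ) (hc : 0 < c) (ε : ℝ) (hε : 0 < ε) (hεp : ε < p)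
    (α : ℝ) (hαδ : α = δ ^ (p - ε)) (hδα : 2 * δ ^ p ≤ c * α)
    (uαδ : U) (huD : uαδ ∈ D)
    (hmin : ∀ w ∈ D, ‖F uαδ - vδ‖ ^ p + α * R uαδ ≤ ‖F w - vδ‖ ^ p + α * R w) :
    ‖F uαδ - vδ‖ ≤ (c / 2 + R udag) ^ (1 / p) * δ ^ ((p - ε) / p) := by
  have hp0 : 0 < p := by linarith
  have hα : 0 < α := hαδ ▸ Real.rpow_pos_of_pos hδ _
  have h1 := hmin udag hudagD
  have h2 : ‖F udag - vδ‖ ^ p ≤ δ ^ p := by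
    apply Real.rpow_le_rpow (norm_nonneg _) _ hp0.le
    rw [hFudag, norm_sub_rev]
    exact hvδ
  have h3 : 0 ≤ α * R uαδ := mul_nonneg hα.le (hR _)
  have h4 : 0 ≤ c / 2 + R udag := by linarith [hR udag]
  have h5 : ‖F uαδ - vδ‖ ^ p ≤ (c / 2 + R udag) * α := by nlinarith
  have h6 : δ ^ ((p - ε) / p) = α ^ (1 / p) := by
    rw [hαδ, ← Real.rpow_mul hδ.le, mul_one_div]
  rw [h6, ← Real.mul_rpow h4 hα.le]
  calc ‖F uαδ - vδ‖ = (‖F uαδ - vδ‖ ^ p) ^ (1 / p) := by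
        rw [← Real.rpow_mul (norm_nonneg _), mul_one_div_cancel hp0.ne', Real.rpow_one]
    _ ≤ _ := Real.rpow_le_rpow (Real.rpow_nonneg (norm_nonneg _) _) h5 (by positivity)
end
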